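/- The series of layer heights converges: ∑_{l≥1} H_l < +∞, where H_l := S_l^{−(1+ε)/3}. -/

import Mathlib

noncomputable section

namespace CubePacking

/-- The side lengths `ℓ_k := k^{−(1+ε)/3}`. -/
def sideLen (ε : ℝ) (k : ℕ) : ℝ := (k : ℝ) ^ (-(1 + ε) / 3)

/-- `L_n^m := ∑_{k=n}^m ℓ_k`, the length needed to put the cubes `n,…,m` in a row. -/
def L (ε : ℝ) (n m : ℕ) : ℝ := ∑ k ∈ Finset.Icc n m, sideLen ε k

/-- `M_n := max{m ≥ n : L_n^m ≤ 1} − n + 1`, the number of cubes, starting from the `n`-th,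
fitting in a row of length `1`.  (The maximum exists for `n ≥ 1` since `ℓ_n ≤ 1` and
`L_n^m → ∞` as `m → ∞`; it is realized here by `sSup`, which coincides with the maximum
of a nonempty bounded-above set of naturals.) -/
def M (ε : ℝ) (n : ℕ) : ℕ := sSup {m : ℕ | n ≤ m ∧ L ε n m ≤ 1} - n + 1

/-- The index `B^n_r` of the first cube of the `r`-th row when rows are started at the `n`-th
cube: `B^n_1 := n` and `B^n_{r+1} := B^n_r + M_{B^n_r}` for `r ≥ 1`. -/
def B (ε : ℝ) (n : ℕ) : ℕ → ℕ
  | 0 => n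
  | 1 => n
  | r + 2 => B ε n (r + 1) + M ε (B ε n (r + 1))

/-- `W_n^R := ∑_{r=1}^R (B^n_r)^{−(1+ε)/3}`, the width occupied by `R` rows starting at the
`n`-th cube. -/
def W (ε : ℝ) (n R : ℕ) : ℝ := ∑ r ∈ Finset.Icc 1 R, (B ε n r : ℝ) ^ (-(1 + ε) / 3)

/-- `R_n := max{R ≥ 1 : W_n^R ≤ 1}`, the number of rows fitting in the unit square starting
from the `n`-th cube.  (Again the maximum is realized by `sSup`.) -/
def Rn (ε : ℝ) (n : ℕ) : ℕ := sSup {R : ℕ | 1 ≤ R ∧ W ε n R ≤ 1}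

/-- `N_n := B^n_{R_n+1} − n + 1`, the number of cubes in those rows. -/
def N (ε : ℝ) (n : ℕ) : ℕ := B ε n (Rn ε n + 1) - n + 1

/-- The index `S_l` of the cube starting the `l`-th vertical layer:
`S_1 := 1` and `S_{l+1} := S_l + N_{S_l}` for `l ≥ 1`. -/
def S (ε : ℝ) : ℕ → ℕ
  | 0 => 1
  | 1 => 1
  | l + 2 => S ε (l + 1) + N ε (S ε (l + 1))

/-- The height `H_l := S_l^{−(1+ε)/3}` of the `l`-th layer. -/
def H (ε : ℝ) (l : ℕ) : ℝ := (S ε l : ℝ) ^ (-(1 + ε) / 3)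

end CubePacking

namespace CubePacking

lemma sideLen_nonneg (ε : ℝ) (k : ℕ) : 0 ≤ sideLen ε k :=
  Real.rpow_nonneg (Nat.cast_nonneg k) _

lemma sideLen_anti {ε : ℝ} (hε : 0 < ε) {m n : ℕ} (hm : 1 ≤ m) (hmn : m ≤ n) :
    sideLen ε n ≤ sideLen ε m := by
  refine Real.rpow_le_rpow_of_nonpos (by positivity) (by exact_mod_cast hmn) (by linarith)

lemma sideLen_le_one {ε : ℝ} (hε : 0 < ε) {n : ℕ} (hn : 1 ≤ n) : sideLen ε n ≤ 1 := by
  simpa [sideLen] using sideLen_anti hε le_rfl hn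

/-- As many copies of `ℓ_n` fit into length `1` as the integer part of `n^{(1+ε)/3}`. -/
lemma floor_mul_sideLen_le_one (ε : ℝ) {n : ℕ} (hn : 1 ≤ n) :
    (⌊(n : ℝ) ^ ((1 + ε) / 3)⌋₊ : ℝ) * sideLen ε n ≤ 1 := by
  have hn' : (0 : ℝ) < n := by exact_mod_cast hn
  calc (⌊(n : ℝ) ^ ((1 + ε) / 3)⌋₊ : ℝ) * sideLen ε n
      ≤ (n : ℝ) ^ ((1 + ε) / 3) * sideLen ε n :=
        mul_le_mul_of_nonneg_right (Nat.floor_le (by positivity)) (sideLen_nonneg ε n)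
    _ = 1 := by
        rw [sideLen, ← Real.rpow_add hn', neg_div, add_neg_cancel, Real.rpow_zero]

lemma one_le_floor_rpow {a : ℝ} (ha : 0 ≤ a) {n : ℕ} (hn : 1 ≤ n) : 1 ≤ ⌊(n : ℝ) ^ a⌋₊ :=
  Nat.le_floor (by simpa using Real.one_le_rpow (by exact_mod_cast hn) ha)

lemma tendsto_sum_sq_sideLen {ε : ℝ} (hε : ε < 1 / 2) (n : ℕ) :
    Filter.Tendsto (fun m => ∑ k ∈ Finset.Ico n m, sideLen ε k ^ 2) Filter.atTop Filter.atTop := by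
  have h : ¬ Summable fun k => sideLen ε k ^ 2 := by
    have h2 : (fun k => sideLen ε k ^ 2) = fun k : ℕ => (k : ℝ) ^ (-(1 + ε) / 3 * 2) := by
      ext k
      rw [sideLen, Real.rpow_mul (Nat.cast_nonneg k)]
      norm_cast
    rw [h2, Real.summable_nat_rpow]
    linarith
  rw [not_summable_iff_tendsto_nat_atTop_of_nonneg fun k => sq_nonneg _] at h
  refine (Filter.tendsto_atTop_add_const_right _
    (-∑ k ∈ Finset.range n, sideLen ε k ^ 2) h).congr' ?_
  filter_upwards [Filter.eventually_ge_atTop n] with m hm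
  rw [Finset.sum_Ico_eq_sub _ hm, sub_eq_add_neg]

lemma bddAbove_row {ε : ℝ} (hε0 : 0 < ε) (hε : ε < 1 / 2) {n : ℕ} (hn : 1 ≤ n) :
    BddAbove {m : ℕ | n ≤ m ∧ L ε n m ≤ 1} := by
  obtain ⟨K, hK⟩ := Filter.eventually_atTop.1
    ((tendsto_sum_sq_sideLen hε n).eventually_gt_atTop 1)
  refine ⟨K, fun m hm => ?_⟩
  by_contra! h
  have h1 := hK m h.le
  have h2 : ∑ k ∈ Finset.Ico n m, sideLen ε k ^ 2 ≤ L ε n m := by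
    refine (Finset.sum_le_sum fun k hk => ?_).trans
      (Finset.sum_le_sum_of_subset_of_nonneg Finset.Ico_subset_Icc_self
        fun k _ _ => sideLen_nonneg ε k)
    have hk1 := sideLen_le_one hε0 (hn.trans (Finset.mem_Ico.1 hk).1)
    nlinarith [sideLen_nonneg ε k]
  linarith [hm.2]

/-- A full row has length at most `1`. -/
lemma sum_row_le_one {ε : ℝ} (hε0 : 0 < ε) (hε : ε < 1 / 2) {n : ℕ} (hn : 1 ≤ n) :
    ∑ k ∈ Finset.Ico n (n + M ε n), sideLen ε k ≤ 1 := by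
  have hne : {m : ℕ | n ≤ m ∧ L ε n m ≤ 1}.Nonempty :=
    ⟨n, le_rfl, by simpa [L] using sideLen_le_one hε0 hn⟩
  obtain ⟨h1, h2⟩ := Nat.sSup_mem hne (bddAbove_row hε0 hε hn)
  have h3 : n + M ε n = sSup {m : ℕ | n ≤ m ∧ L ε n m ≤ 1} + 1 := by
    unfold M
    omega
  rw [h3]
  exact h2

lemma floor_le_M {ε : ℝ} (hε0 : 0 < ε) (hε : ε < 1 / 2) {n : ℕ} (hn : 1 ≤ n) :
    ⌊(n : ℝ) ^ ((1 + ε) / 3)⌋₊ ≤ M ε n := by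
  have hf := one_le_floor_rpow (a := (1 + ε) / 3) (by linarith) hn
  have hfit := floor_mul_sideLen_le_one ε hn
  set f := ⌊(n : ℝ) ^ ((1 + ε) / 3)⌋₊
  have hmem : n + f - 1 ∈ {m : ℕ | n ≤ m ∧ L ε n m ≤ 1} := by
    refine ⟨by omega, le_trans ?_ hfit⟩
    have h := Finset.sum_le_card_nsmul (Finset.Icc n (n + f - 1)) (sideLen ε) (sideLen ε n)
      fun k hk => sideLen_anti hε0 hn (Finset.mem_Icc.1 hk).1
    rwa [Nat.card_Icc, nsmul_eq_mul, show n + f - 1 + 1 - n = f by omega] at h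
  have := le_csSup (bddAbove_row hε0 hε hn) hmem
  unfold M
  omega

lemma add_mul_floor_le_B {ε : ℝ} (hε0 : 0 < ε) (hε : ε < 1 / 2) {n : ℕ} (hn : 1 ≤ n) (R : ℕ) :
    n + R * ⌊(n : ℝ) ^ ((1 + ε) / 3)⌋₊ ≤ B ε n (R + 1) := by
  induction R with
  | zero => simp [B]
  | succ R ih =>
    have hB : n ≤ B ε n (R + 1) := le_trans (Nat.le_add_right _ _) ih
    have h1 := floor_le_M hε0 hε (hn.trans hB)
    have h2 : ⌊(n : ℝ) ^ ((1 + ε) / 3)⌋₊ ≤ ⌊(B ε n (R + 1) : ℝ) ^ ((1 + ε) / 3)⌋₊ :=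
      Nat.floor_mono (Real.rpow_le_rpow (by positivity) (by exact_mod_cast hB) (by linarith))
    rw [B, add_mul, one_mul]
    omega

lemma le_B {ε : ℝ} (hε0 : 0 < ε) (hε : ε < 1 / 2) {n : ℕ} (hn : 1 ≤ n) (r : ℕ) :
    n ≤ B ε n r := by
  cases r with
  | zero => simp [B]
  | succ R => exact le_trans (Nat.le_add_right _ _) (add_mul_floor_le_B hε0 hε hn R)

/-- The total width of the first `R` rows is at least the total squared side length of their cubes. -/
lemma sum_sq_le_W {ε : ℝ} (hε0 : 0 < ε) (hε : ε < 1 / 2) {n : ℕ} (hn : 1 ≤ n) (R : ℕ) :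
    ∑ k ∈ Finset.Ico n (B ε n (R + 1)), sideLen ε k ^ 2 ≤ W ε n R := by
  induction R with
  | zero => simp [B, W]
  | succ R ih =>
    have hB := le_B hε0 hε hn (R + 1)
    have hW : W ε n (R + 1) = W ε n R + sideLen ε (B ε n (R + 1)) :=
      Finset.sum_Icc_succ_top (by omega) _
    rw [hW, B, ← Finset.sum_Ico_consecutive _ hB (Nat.le_add_right _ _)]
    set b := B ε n (R + 1)
    refine add_le_add ih ?_
    calc ∑ k ∈ Finset.Ico b (b + M ε b), sideLen ε k ^ 2
        ≤ ∑ k ∈ Finset.Ico b (b + M ε b), sideLen ε b * sideLen ε k := by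
          refine Finset.sum_le_sum fun k hk => ?_
          rw [sq]
          exact mul_le_mul_of_nonneg_right
            (sideLen_anti hε0 (hn.trans hB) (Finset.mem_Ico.1 hk).1) (sideLen_nonneg ε k)
      _ = sideLen ε b * ∑ k ∈ Finset.Ico b (b + M ε b), sideLen ε k := by rw [Finset.mul_sum]
      _ ≤ sideLen ε b :=
          mul_le_of_le_one_right (sideLen_nonneg ε b) (sum_row_le_one hε0 hε (hn.trans hB))

lemma bddAbove_rows {ε : ℝ} (hε0 : 0 < ε) (hε : ε < 1 / 2) {n : ℕ} (hn : 1 ≤ n) :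
    BddAbove {R : ℕ | 1 ≤ R ∧ W ε n R ≤ 1} := by
  obtain ⟨K, hK⟩ := Filter.eventually_atTop.1
    ((tendsto_sum_sq_sideLen hε n).eventually_gt_atTop 1)
  refine ⟨K, fun R hR => ?_⟩
  by_contra! h
  have h1 := add_mul_floor_le_B hε0 hε hn R
  have h2 := Nat.le_mul_of_pos_right R (one_le_floor_rpow (a := (1 + ε) / 3) (by linarith) hn)
  have h3 := hK (B ε n (R + 1)) (by omega)
  linarith [hR.2, sum_sq_le_W hε0 hε hn R]

lemma floor_le_Rn {ε : ℝ} (hε0 : 0 < ε) (hε : ε < 1 / 2) {n : ℕ} (hn : 1 ≤ n) :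
    ⌊(n : ℝ) ^ ((1 + ε) / 3)⌋₊ ≤ Rn ε n := by
  refine le_csSup (bddAbove_rows hε0 hε hn)
    ⟨one_le_floor_rpow (by linarith) hn, le_trans ?_ (floor_mul_sideLen_le_one ε hn)⟩
  set f := ⌊(n : ℝ) ^ ((1 + ε) / 3)⌋₊
  have h := Finset.sum_le_card_nsmul (Finset.Icc 1 f) (fun r => sideLen ε (B ε n r)) (sideLen ε n)
    fun r _ => sideLen_anti hε0 hn (le_B hε0 hε hn r)
  rwa [Nat.card_Icc, nsmul_eq_mul, Nat.add_sub_cancel] at h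

/-- A layer starting at the `n`-th cube contains at least `n^{2(1+ε)/3} / 4` cubes. -/
lemma rpow_div_four_le_N {ε : ℝ} (hε0 : 0 < ε) (hε : ε < 1 / 2) {n : ℕ} (hn : 1 ≤ n) :
    (n : ℝ) ^ (2 * ((1 + ε) / 3)) / 4 ≤ N ε n := by
  have hf := one_le_floor_rpow (a := (1 + ε) / 3) (by linarith) hn
  have hlt := Nat.lt_floor_add_one ((n : ℝ) ^ ((1 + ε) / 3))
  have hR := floor_le_Rn hε0 hε hn
  have hB := add_mul_floor_le_B hε0 hε hn (Rn ε n)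
  have hpos : (0 : ℝ) ≤ (n : ℝ) ^ ((1 + ε) / 3) := by positivity
  rw [mul_comm, Real.rpow_mul (Nat.cast_nonneg n), Real.rpow_two]
  set f := ⌊(n : ℝ) ^ ((1 + ε) / 3)⌋₊
  set x := (n : ℝ) ^ ((1 + ε) / 3)
  have hN : f * f ≤ N ε n := by
    have := Nat.mul_le_mul_right f hR
    unfold N
    omega
  have hN' : (f : ℝ) * f ≤ N ε n := by exact_mod_cast hN
  have hf' : (1 : ℝ) ≤ f := by exact_mod_cast hf
  nlinarith

lemma one_le_S (ε : ℝ) (l : ℕ) : 1 ≤ S ε l := by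
  induction l with
  | zero => simp [S]
  | succ l ih =>
    cases l with
    | zero => simp [S]
    | succ l => rw [S]; omega

end CubePacking

lemma add_one_rpow_le {p x : ℝ} (hp : 1 ≤ p) (hx : 1 ≤ x) :
    (x + 1) ^ p ≤ x ^ p + p * 2 ^ (p - 1) * x ^ (p - 1) := by
  have hx1 : 0 < x + 1 := by linarith
  have hb := one_add_mul_self_le_rpow_one_add (s := -(1 / (x + 1)))
    (by rw [neg_le_neg_iff, div_le_one hx1]; linarith) hp
  have h1 : 1 + -(1 / (x + 1)) = x / (x + 1) := by field_simp; ring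
  rw [h1, Real.div_rpow (by linarith) hx1.le, le_div_iff₀ (by positivity)] at hb
  have h2 : (x + 1) ^ p = (x + 1) ^ (p - 1) * (x + 1) := by
    rw [← Real.rpow_add_one hx1.ne', sub_add_cancel]
  have h3 : (x + 1) ^ (p - 1) ≤ 2 ^ (p - 1) * x ^ (p - 1) := by
    rw [← Real.mul_rpow (by norm_num) (by linarith)]
    exact Real.rpow_le_rpow hx1.le (by linarith) (by linarith)
  have h4 : (1 + p * -(1 / (x + 1))) * (x + 1) ^ p = (x + 1) ^ p - p * (x + 1) ^ (p - 1) := by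
    rw [h2]; field_simp
    ring
  rw [h4] at hb
  nlinarith [mul_le_mul_of_nonneg_left h3 (by linarith : (0 : ℝ) ≤ p)]

/-- A sequence with `u (l + 1) ≥ u l + (u l)^b / 4`, where `b < 1`, grows at least like
`l^{1/(1-b)}`. -/
lemma exists_mul_rpow_le_of_add_rpow_le {b : ℝ} (hb0 : 0 ≤ b) (hb1 : b < 1) {u : ℕ → ℝ}
    (h1 : 1 ≤ u 1) (hu : ∀ l, 1 ≤ l → u l + u l ^ b / 4 ≤ u (l + 1)) :
    ∃ c : ℝ, 0 < c ∧ ∀ l : ℕ, 1 ≤ l → c * (l : ℝ) ^ (1 / (1 - b)) ≤ u l := by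
  have hb : 0 < 1 - b := by linarith
  set p := 1 / (1 - b) with hp
  have hp1 : 1 ≤ p := by rw [hp, le_div_iff₀ hb]; linarith
  have hpb : p * b = p - 1 := by rw [hp]; field_simp; ring
  set K := p * 2 ^ (p - 1) with hK
  have hK1 : 1 ≤ K := by
    have : (1 : ℝ) ≤ 2 ^ (p - 1) := Real.one_le_rpow (by norm_num) (by linarith)
    nlinarith
  have hK4 : 0 < 4 * K := by linarith
  refine ⟨(4 * K) ^ (-p), by positivity, fun l hl => ?_⟩
  induction l, hl using Nat.le_induction with
  | base =>
    have : (4 * K) ^ (-p) ≤ 1 := Real.rpow_le_one_of_one_le_of_nonpos (by linarith) (by linarith)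
    simpa using this.trans h1
  | succ l hl ih =>
    have hx : (1 : ℝ) ≤ l := by exact_mod_cast hl
    refine le_trans ?_ (hu l hl)
    have hc : ((4 * K) ^ (-p)) ^ b = (4 * K) ^ (-p) * (4 * K) := by
      rw [← Real.rpow_mul hK4.le, ← Real.rpow_add_one hK4.ne']
      congr 1
      linarith
    have hpow : (4 * K) ^ (-p) * (4 * K) * (l : ℝ) ^ (p - 1) ≤ u l ^ b := by
      have := Real.rpow_le_rpow (by positivity) ih hb0
      rwa [Real.mul_rpow (by positivity) (by positivity), hc,
        ← Real.rpow_mul (by positivity), hpb] at this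
    have hstep := mul_le_mul_of_nonneg_left (add_one_rpow_le hp1 hx)
      (by positivity : 0 ≤ (4 * K) ^ (-p))
    rw [← hK] at hstep
    push_cast
    linarith

open CubePacking in
/-- Cube packing: the layer heights sum up to a finite total height.
The series `∑_{l≥1} H_l` of layer heights `H_l = S_l^{−(1+ε)/3}` converges. -/
theorem layer_heights_summable (ε : ℝ) (hε0 : 0 < ε) (hε : ε < 1 / 2) :
    Summable fun l : ℕ => H ε l := by
  obtain ⟨c, hc, hS⟩ := exists_mul_rpow_le_of_add_rpow_le (b := 2 * ((1 + ε) / 3))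
    (u := fun l => (S ε l : ℝ)) (by linarith) (by linarith) (by simp [S]) fun l hl => by
      obtain ⟨l, rfl⟩ := Nat.exists_eq_add_of_le' hl
      have := rpow_div_four_le_N hε0 hε (one_le_S ε (l + 1))
      simp only [S]
      push_cast
      linarith
  set p := 1 / (1 - 2 * ((1 + ε) / 3)) with hp
  have hs : Summable fun l : ℕ => c ^ (-(1 + ε) / 3) * (l : ℝ) ^ (p * (-(1 + ε) / 3)) := by
    refine (Real.summable_nat_rpow.2 ?_).mul_left _
    rw [hp, one_div_mul_eq_div, div_lt_iff₀ (by linarith)]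
    linarith
  rw [← summable_nat_add_iff 1] at hs ⊢
  refine hs.of_nonneg_of_le (fun l => Real.rpow_nonneg (Nat.cast_nonneg _) _) fun l => ?_
  rw [Real.rpow_mul (Nat.cast_nonneg _), ← Real.mul_rpow hc.le (by positivity)]
  exact Real.rpow_le_rpow_of_nonpos (by positivity) (hS (l + 1) (by omega)) (by linarith)
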